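/- arXiv:1601.06888 — 2 statements merged into one kernel-verified Lean document; each statement's English description precedes it below -/
import Mathlib

section
/- The quantity Γ is multiplicative under tensor products of channels: Γ(N ⊗ M) = Γ(N) · Γ(M), where Γ(N) is the optimal value of the SDP max tr(J_N R) subject to R Hermitian, ρ a density operator, −ρ ⊗ I ≤ R^{T_B} ≤ ρ ⊗ I. Consequently Q_Γ(N ⊗ M) = Q_Γ(N) + Q_Γ(M) with Q_Γ = log Γ. -/
open Matrix
open scoped Kronecker ComplexOrder

/-- Loewner order: `Loe M N` means `M ≤ N`. -/
def Loe {n : Type*} [Fintype n] (M N : Matrix n n ℂ) : Prop := (N - M).PosSemidef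

/-- Partial transpose on the second tensor factor. -/
def PTb {A B : Type*} (M : Matrix (A × B) (A × B) ℂ) : Matrix (A × B) (A × B) ℂ :=
  fun p q => M (p.1, q.2) (q.1, p.2)

/-- Partial trace over the second tensor factor. -/
noncomputable def trB {A B : Type*} [Fintype B]
    (M : Matrix (A × B) (A × B) ℂ) : Matrix A A ℂ :=
  fun i j => ∑ b, M (i, b) (j, b)

/-- The set of values `tr(J R)` of the SDP `Γ`. -/
def GammaSet {A B : Type*} [Fintype A] [Fintype B] [DecidableEq B]
    (J : Matrix (A × B) (A × B) ℂ) : Set ℝ :=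
  {t : ℝ | ∃ (R : Matrix (A × B) (A × B) ℂ) (ρ : Matrix A A ℂ),
    R.IsHermitian ∧ ρ.PosSemidef ∧ ρ.trace = 1 ∧
    Loe (-(ρ ⊗ₖ (1 : Matrix B B ℂ))) (PTb R) ∧
    Loe (PTb R) (ρ ⊗ₖ (1 : Matrix B B ℂ)) ∧
    (J * R).trace = (t : ℂ)}

/-- The Choi matrix of `N ⊗ M`: the tensor product `J_N ⊗ J_M` with the
tensor factors reordered as `(A1 × A2) × (B1 × B2)`. -/
def choiTensor {A1 B1 A2 B2 : Type*}
    (J1 : Matrix (A1 × B1) (A1 × B1) ℂ) (J2 : Matrix (A2 × B2) (A2 × B2) ℂ) :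
    Matrix ((A1 × A2) × (B1 × B2)) ((A1 × A2) × (B1 × B2)) ℂ :=
  fun p q => J1 (p.1.1, p.2.1) (q.1.1, q.2.1) * J2 (p.1.2, p.2.2) (q.1.2, q.2.2)

theorem Matrix.PosSemidef.real_smul {n : Type*} {M : Matrix n n ℂ} (hM : M.PosSemidef)
    {c : ℝ} (hc : 0 ≤ c) : (c • M).PosSemidef :=
  hM.smul hc

section PosSemidefFacts

variable {n : Type*} [Fintype n]

theorem Matrix.IsHermitian.exists_posSemidef_add_smul_one [DecidableEq n]
    {X : Matrix n n ℂ} (hX : X.IsHermitian) :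
    ∃ k : ℝ, 0 ≤ k ∧ (X + k • (1 : Matrix n n ℂ)).PosSemidef := by
  open scoped MatrixOrder Matrix.Norms.L2Operator in
  have h := IsSelfAdjoint.neg_algebraMap_norm_le_self (a := X) hX
  refine ⟨_, norm_nonneg X, ?_⟩
  rw [Matrix.le_iff, sub_neg_eq_add, Algebra.algebraMap_eq_smul_one] at h
  exact h

theorem Matrix.PosSemidef.trace_mul_nonneg {M N : Matrix n n ℂ} (hM : M.PosSemidef)
    (hN : N.PosSemidef) : 0 ≤ (M * N).trace := by
  classical
  open scoped MatrixOrder in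
  obtain ⟨B, rfl⟩ := CStarAlgebra.nonneg_iff_eq_star_mul_self.mp hM.nonneg
  rw [Matrix.star_eq_conjTranspose, Matrix.mul_assoc, Matrix.trace_mul_comm]
  exact (hN.mul_mul_conjTranspose_same B).trace_nonneg

theorem Matrix.IsHermitian.im_trace_mul {M N : Matrix n n ℂ} (hM : M.IsHermitian)
    (hN : N.IsHermitian) : (M * N).trace.im = 0 := by
  rw [← Complex.conj_eq_iff_im, starRingEnd_apply, ← Matrix.trace_conjTranspose,
    Matrix.conjTranspose_mul, hM.eq, hN.eq, Matrix.trace_mul_comm]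

theorem Matrix.IsHermitian.posSemidef_of_trace_mul_nonneg {M : Matrix n n ℂ}
    (hM : M.IsHermitian)
    (h : ∀ V : Matrix n n ℂ, V.PosSemidef → 0 ≤ (M * V).trace.re) : M.PosSemidef := by
  refine .of_dotProduct_mulVec_nonneg hM fun x => ?_
  have hV := Matrix.posSemidef_vecMulVec_self_star x
  have key : (M * vecMulVec x (star x)).trace = star x ⬝ᵥ (M *ᵥ x) := by
    rw [Matrix.mul_vecMulVec, Matrix.trace_vecMulVec, dotProduct_comm]
  rw [← key, Complex.nonneg_iff]
  exact ⟨h _ hV, (hM.im_trace_mul hV.1).symm⟩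

/-- Every real functional on Hermitian matrices is `X ↦ tr (R X)` with `R` Hermitian. -/
theorem exists_isHermitian_trace_eq
    (g : selfAdjoint (Matrix n n ℂ) →ₗ[ℝ] ℝ) :
    ∃ R : Matrix n n ℂ, R.IsHermitian ∧
      ∀ X : selfAdjoint (Matrix n n ℂ), g X = (R * (X : Matrix n n ℂ)).trace.re := by
  let Φ : selfAdjoint (Matrix n n ℂ) →ₗ[ℝ] Module.Dual ℝ (selfAdjoint (Matrix n n ℂ)) :=
    LinearMap.mk₂ ℝ (fun R X => ((R : Matrix n n ℂ) * (X : Matrix n n ℂ)).trace.re)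
      (fun a b c => by simp [Matrix.add_mul]) (fun a b c => by simp)
      (fun a b c => by simp [Matrix.mul_add]) (fun a b c => by simp)
  have hfd : FiniteDimensional ℝ (selfAdjoint (Matrix n n ℂ)) :=
    inferInstanceAs (FiniteDimensional ℝ (selfAdjoint.submodule ℝ (Matrix n n ℂ)))
  have hinj : Function.Injective Φ := by
    rw [injective_iff_map_eq_zero]
    intro R hR
    have h0 : ((R : Matrix n n ℂ) * (R : Matrix n n ℂ)).trace.re = 0 :=
      LinearMap.congr_fun hR R
    have hRh : (R : Matrix n n ℂ).IsHermitian := R.2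
    have h1 : ((R : Matrix n n ℂ)ᴴ * (R : Matrix n n ℂ)).trace = 0 := by
      rw [hRh.eq]
      exact Complex.ext h0 (hRh.im_trace_mul hRh)
    exact Subtype.ext (Matrix.trace_conjTranspose_mul_self_eq_zero_iff.mp h1)
  obtain ⟨R, hR⟩ := (LinearMap.injective_iff_surjective_of_finrank_eq_finrank
    Subspace.dual_finrank_eq.symm).mp hinj g
  exact ⟨R, R.2, fun X => by rw [← hR]; rfl⟩

end PosSemidefFacts

section PartialMaps

variable {A B : Type*}

@[simp] theorem PTb_PTb (M : Matrix (A × B) (A × B) ℂ) : PTb (PTb M) = M := rfl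

theorem Matrix.IsHermitian.PTb {M : Matrix (A × B) (A × B) ℂ} (hM : M.IsHermitian) :
    (PTb M).IsHermitian := by
  ext p q
  exact hM.apply (p.1, q.2) (q.1, p.2)

theorem trace_PTb_mul_PTb [Fintype A] [Fintype B] (M N : Matrix (A × B) (A × B) ℂ) :
    (PTb M * PTb N).trace = (M * N).trace := by
  simp only [Matrix.trace, Matrix.diag, Matrix.mul_apply, PTb, Fintype.sum_prod_type]
  refine Finset.sum_congr rfl fun a _ => ?_
  rw [Finset.sum_comm]
  conv_rhs => rw [Finset.sum_comm]
  refine Finset.sum_congr rfl fun a' _ => ?_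
  rw [Finset.sum_comm]

theorem PTb_kronecker_one [DecidableEq B] (ρ : Matrix A A ℂ) :
    PTb (ρ ⊗ₖ (1 : Matrix B B ℂ)) = ρ ⊗ₖ (1 : Matrix B B ℂ) := by
  ext p q
  simp [PTb, Matrix.kroneckerMap_apply, Matrix.one_apply, eq_comm]

variable [Fintype B]

theorem trB_add (M N : Matrix (A × B) (A × B) ℂ) : trB (M + N) = trB M + trB N := by
  ext i j
  simp [trB, Finset.sum_add_distrib]

theorem trB_smul (c : ℝ) (M : Matrix (A × B) (A × B) ℂ) : trB (c • M) = c • trB M := by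
  ext i j
  simp [trB, Finset.mul_sum]

theorem Matrix.PosSemidef.trB {M : Matrix (A × B) (A × B) ℂ} (hM : M.PosSemidef) :
    (trB M).PosSemidef := by
  have h : _root_.trB M = ∑ b : B, M.submatrix (fun a => (a, b)) (fun a => (a, b)) := by
    ext i j
    simp [_root_.trB, Matrix.sum_apply]
  rw [h]
  exact Matrix.posSemidef_sum _ fun b _ => hM.submatrix _

theorem trace_kronecker_one_mul [Fintype A] [DecidableEq B] (ρ : Matrix A A ℂ)
    (M : Matrix (A × B) (A × B) ℂ) :
    ((ρ ⊗ₖ (1 : Matrix B B ℂ)) * M).trace = (ρ * trB M).trace := by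
  simp only [Matrix.trace, Matrix.diag, Matrix.mul_apply, trB, Fintype.sum_prod_type,
    Matrix.kroneckerMap_apply, Matrix.one_apply, mul_ite, mul_one, mul_zero, ite_mul, zero_mul,
    Finset.sum_ite_eq, Finset.mem_univ, if_true, Finset.mul_sum]
  exact Finset.sum_congr rfl fun a _ => Finset.sum_comm

end PartialMaps

section Duality

variable {A B : Type*} [Fintype B] [DecidableEq A]

/-- Feasibility of the value `μ` for the SDP dual to `Γ`, where `K` is the partial transpose
of the Choi matrix. -/
def DualFeasible (K : Matrix (A × B) (A × B) ℂ) (μ : ℝ) : Prop :=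
  ∃ V Y : Matrix (A × B) (A × B) ℂ, V.PosSemidef ∧ Y.PosSemidef ∧ V - Y = K ∧
    (μ • (1 : Matrix A A ℂ) - trB (V + Y)).PosSemidef

theorem DualFeasible.mono {K : Matrix (A × B) (A × B) ℂ} {μ ν : ℝ} (h : DualFeasible K μ)
    (hμν : μ ≤ ν) : DualFeasible K ν := by
  obtain ⟨V, Y, hV, hY, hK, hT⟩ := h
  refine ⟨V, Y, hV, hY, hK, ?_⟩
  convert hT.add (Matrix.PosSemidef.one.real_smul (sub_nonneg.mpr hμν)) using 1
  module

variable [Fintype A]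

theorem le_of_mem_GammaSet_of_dualFeasible [DecidableEq B] {J : Matrix (A × B) (A × B) ℂ}
    {t μ : ℝ} (ht : t ∈ GammaSet J) (hμ : DualFeasible (PTb J) μ) : t ≤ μ := by
  obtain ⟨R, ρ, -, hρ, hρ1, hlo, hhi, htr⟩ := ht
  obtain ⟨V, Y, hV, hY, hK, hT⟩ := hμ
  have h1 := hhi.trace_mul_nonneg hV
  have h2 := hlo.trace_mul_nonneg hY
  have h3 := hρ.trace_mul_nonneg hT
  rw [← trace_PTb_mul_PTb, ← hK, Matrix.trace_mul_comm] at htr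
  rw [Matrix.sub_mul, Matrix.trace_sub, trace_kronecker_one_mul] at h1
  rw [sub_neg_eq_add, Matrix.add_mul, Matrix.trace_add, trace_kronecker_one_mul] at h2
  rw [Matrix.mul_sub, Matrix.trace_sub, Matrix.mul_smul, Matrix.mul_one, Matrix.trace_smul,
    hρ1, trB_add, Matrix.mul_add, Matrix.trace_add] at h3
  rw [Matrix.mul_sub, Matrix.trace_sub] at htr
  have h4 := add_nonneg (add_nonneg h1 h2) h3
  have h5 : 0 ≤ ((μ - t : ℝ) : ℂ) := by
    convert h4 using 1
    rw [Complex.ofReal_sub, ← htr]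
    simp
    ring
  exact sub_nonneg.mp (Complex.zero_le_real.mp h5)

/-- The cone generated by the feasible directions of the dual SDP and `-(K, μ I)`. -/
def dualCone (K : selfAdjoint (Matrix (A × B) (A × B) ℂ)) (μ : ℝ) :
    PointedCone ℝ (selfAdjoint (Matrix (A × B) (A × B) ℂ) × selfAdjoint (Matrix A A ℂ)) where
  carrier := {x | ∃ (l : ℝ) (V Y : Matrix (A × B) (A × B) ℂ), 0 ≤ l ∧ V.PosSemidef ∧
    Y.PosSemidef ∧ V - Y = x.1.1 + l • K.1 ∧
    (x.2.1 + (l * μ) • (1 : Matrix A A ℂ) - trB (V + Y)).PosSemidef}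
  zero_mem' := ⟨0, 0, 0, le_rfl, .zero, .zero, by simp, by
    have h : trB (0 : Matrix (A × B) (A × B) ℂ) = 0 := by ext; simp [trB]
    simpa [h] using Matrix.PosSemidef.zero⟩
  add_mem' := by
    rintro x y ⟨l, V, Y, hl, hV, hY, hx, hT⟩ ⟨l', V', Y', hl', hV', hY', hx', hT'⟩
    refine ⟨l + l', V + V', Y + Y', add_nonneg hl hl', hV.add hV', hY.add hY', ?_, ?_⟩
    · rw [add_sub_add_comm, hx, hx']
      simp only [Prod.fst_add, AddSubgroup.coe_add]
      module
    · convert hT.add hT' using 1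
      simp only [Prod.snd_add, AddSubgroup.coe_add, trB_add]
      module
  smul_mem' := by
    rintro ⟨c, hc⟩ x ⟨l, V, Y, hl, hV, hY, hx, hT⟩
    refine ⟨c * l, c • V, c • Y, mul_nonneg hc hl, hV.real_smul hc, hY.real_smul hc, ?_, ?_⟩
    · rw [← smul_sub, hx]
      change _ = c • x.1.1 + _
      module
    · convert hT.real_smul hc using 1
      change c • x.2.1 + _ - _ = _
      rw [← smul_add, trB_smul]
      module

/-- Strong duality, in the form: a value that is not dual feasible is dominated by a primal
feasible one. -/
theorem exists_mem_GammaSet_of_not_dualFeasible [DecidableEq B] [Nonempty A]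
    {J : Matrix (A × B) (A × B) ℂ} (hJ : J.IsHermitian) {μ : ℝ}
    (hμ : ¬ DualFeasible (PTb J) μ) : ∃ t ∈ GammaSet J, μ ≤ t := by
  let K : selfAdjoint (Matrix (A × B) (A × B) ℂ) := ⟨PTb J, hJ.PTb⟩
  have hne : ((0 : selfAdjoint (Matrix (A × B) (A × B) ℂ)),
      (1 : selfAdjoint (Matrix A A ℂ))) ≠ 0 := by
    intro h
    exact one_ne_zero (α := Matrix A A ℂ) (congrArg (fun x => x.2.1) h)
  obtain ⟨g, hg1, hg⟩ := riesz_extension (dualCone K μ)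
    (LinearPMap.mkSpanSingleton (0, 1) (1 : ℝ) hne) (by
      rintro ⟨x, hx⟩ hxs
      obtain ⟨b, rfl⟩ := Submodule.mem_span_singleton.mp hx
      have hval : (LinearPMap.mkSpanSingleton ((0 : selfAdjoint (Matrix (A × B) (A × B) ℂ)),
          (1 : selfAdjoint (Matrix A A ℂ))) (1 : ℝ) hne :
          _ →ₗ.[ℝ] ℝ) ⟨_, hx⟩ = b := by
        refine (LinearPMap.mkSpanSingleton'_apply _ _ _ _ _).trans ?_
        simp
      rw [hval]
      by_contra! hb
      obtain ⟨l, V, Y, hl, hV, hY, hx, hT⟩ := hxs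
      simp only [Prod.smul_mk, smul_zero, ZeroMemClass.coe_zero, zero_add] at hx hT
      change (b • (1 : Matrix A A ℂ) + _ - _).PosSemidef at hT
      rcases hl.eq_or_lt with rfl | hl
      · have h := (hT.add (hV.add hY).trB).diag_nonneg (i := Classical.arbitrary A)
        simp only [zero_mul, zero_smul, add_zero, sub_add_cancel] at h
        simp [Complex.nonneg_iff] at h
        linarith
      · refine hμ (DualFeasible.mono (μ := μ + b / l) ⟨l⁻¹ • V, l⁻¹ • Y,
          hV.real_smul (by positivity), hY.real_smul (by positivity), ?_, ?_⟩ ?_)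
        · rw [← smul_sub, hx, inv_smul_smul₀ hl.ne']
        · convert hT.real_smul (inv_nonneg.mpr hl.le) using 1
          rw [← smul_add, trB_smul, ← add_smul, smul_sub, smul_smul]
          congr 2
          field_simp
          ring
        · have := div_neg_of_neg_of_pos hb hl
          linarith)
    (by
      rintro ⟨X, H⟩
      obtain ⟨k, hk, hX⟩ := Matrix.IsHermitian.exists_posSemidef_add_smul_one X.2
      have hk1 : (k • (1 : Matrix (A × B) (A × B) ℂ)).PosSemidef :=
        Matrix.PosSemidef.one.real_smul hk
      obtain ⟨c, -, hc⟩ := Matrix.IsHermitian.exists_posSemidef_add_smul_one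
        ((show H.1.IsHermitian from H.2).sub (hX.add hk1).trB.1)
      refine ⟨⟨c • (0, 1), Submodule.smul_mem _ _ (Submodule.mem_span_singleton_self _)⟩,
        0, _, _, le_rfl, hX, hk1, ?_, ?_⟩
      · simp
      · convert hc using 1
        change c • (1 : Matrix A A ℂ) + H.1 + _ - _ = _
        module)
  obtain ⟨ρ, hρh, hρ⟩ := exists_isHermitian_trace_eq (g ∘ₗ LinearMap.inr ℝ _ _)
  obtain ⟨S, hSh, hS⟩ := exists_isHermitian_trace_eq (g ∘ₗ LinearMap.inl ℝ _ _)
  have hgval : ∀ X H, g (X, H) = (S * X.1).trace.re + (ρ * H.1).trace.re := by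
    intro X H
    rw [← hρ, ← hS, LinearMap.comp_apply, LinearMap.comp_apply, ← map_add]
    simp
  have hρpos : ρ.PosSemidef := hρh.posSemidef_of_trace_mul_nonneg fun H hH => by
    have := hg (0, ⟨H, hH.1⟩) ⟨0, 0, 0, le_rfl, .zero, .zero, by simp, by
      have h : trB (0 : Matrix (A × B) (A × B) ℂ) = 0 := by ext; simp [trB]
      simpa [h] using hH⟩
    rw [hgval] at this
    simpa using this
  have hρ1 : ρ.trace = 1 := by
    have h1 : g (0, 1) = 1 :=
      (hg1 ⟨(0, 1), Submodule.mem_span_singleton_self _⟩).trans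
        (LinearPMap.mkSpanSingleton_apply ℝ ℝ hne (1 : ℝ))
    rw [hgval] at h1
    refine Complex.ext (by simpa using h1) ?_
    simpa using hρh.im_trace_mul (Matrix.isHermitian_one (n := A) (α := ℂ))
  have hP : (ρ ⊗ₖ (1 : Matrix B B ℂ)).IsHermitian := (hρpos.kronecker .one).1
  have hplus : (ρ ⊗ₖ (1 : Matrix B B ℂ) + S).PosSemidef :=
    (hP.add hSh).posSemidef_of_trace_mul_nonneg fun V hV => by
      have := hg (⟨V, hV.1⟩, ⟨trB V, hV.trB.1⟩) ⟨0, V, 0, le_rfl, hV, .zero, by simp, by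
        simpa using Matrix.PosSemidef.zero⟩
      rw [hgval] at this
      rw [Matrix.add_mul, Matrix.trace_add, trace_kronecker_one_mul, Complex.add_re, add_comm]
      exact this
  have hminus : (ρ ⊗ₖ (1 : Matrix B B ℂ) - S).PosSemidef :=
    (hP.sub hSh).posSemidef_of_trace_mul_nonneg fun V hV => by
      have := hg (-⟨V, hV.1⟩, ⟨trB V, hV.trB.1⟩) ⟨0, 0, V, le_rfl, .zero, hV, by simp, by
        simpa using Matrix.PosSemidef.zero⟩
      rw [hgval] at this
      rw [Matrix.sub_mul, Matrix.trace_sub, trace_kronecker_one_mul, Complex.sub_re]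
      simp at this
      linarith
  have hval := hg (-K, -(μ • 1)) ⟨1, 0, 0, zero_le_one, .zero, .zero, by simp, by
    have h : trB (0 : Matrix (A × B) (A × B) ℂ) = 0 := by ext; simp [trB]
    simpa [h] using Matrix.PosSemidef.zero⟩
  rw [hgval] at hval
  simp [hρ1] at hval
  refine ⟨-(S * K.1).trace.re, ⟨PTb (-S), ρ, hSh.neg.PTb, hρpos, hρ1, ?_, ?_, ?_⟩, by linarith⟩
  · simpa [Loe, add_comm, sub_eq_add_neg] using hminus
  · simpa [Loe] using hplus
  · rw [← trace_PTb_mul_PTb, PTb_PTb, Matrix.trace_mul_comm]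
    have := hSh.im_trace_mul K.2
    refine Complex.ext ?_ ?_
    · simp [K]
    · simpa [K] using this

theorem one_mem_GammaSet [DecidableEq B] {J : Matrix (A × B) (A × B) ℂ} (hJ : trB J = 1)
    {ρ : Matrix A A ℂ} (hρ : ρ.PosSemidef) (hρ1 : ρ.trace = 1) : 1 ∈ GammaSet J := by
  have hP : (ρ ⊗ₖ (1 : Matrix B B ℂ)).PosSemidef := hρ.kronecker .one
  refine ⟨ρ ⊗ₖ 1, ρ, hP.1, hρ, hρ1, ?_, ?_, ?_⟩
  · rw [Loe, PTb_kronecker_one, sub_neg_eq_add]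
    exact hP.add hP
  · rw [Loe, PTb_kronecker_one, sub_self]
    exact .zero
  · rw [Matrix.trace_mul_comm, trace_kronecker_one_mul, hJ, Matrix.mul_one, hρ1, Complex.ofReal_one]

theorem one_le_of_isGreatest_GammaSet [DecidableEq B] {J : Matrix (A × B) (A × B) ℂ}
    (hJ : trB J = 1) {g : ℝ} (hg : IsGreatest (GammaSet J) g) : 1 ≤ g := by
  obtain ⟨_, ρ, _, hρ, hρ1, _⟩ := hg.1
  exact hg.2 (one_mem_GammaSet hJ hρ hρ1)

theorem dualFeasible_of_isGreatest_lt [DecidableEq B] {J : Matrix (A × B) (A × B) ℂ}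
    (hJ : J.IsHermitian) {g μ : ℝ} (hg : IsGreatest (GammaSet J) g) (hμ : g < μ) :
    DualFeasible (PTb J) μ := by
  obtain ⟨_, ρ, _, _, hρ1, _⟩ := hg.1
  have : Nonempty A := by
    by_contra h
    rw [not_nonempty_iff] at h
    simp [Matrix.trace] at hρ1
  by_contra h
  obtain ⟨t, ht, hμt⟩ := exists_mem_GammaSet_of_not_dualFeasible hJ h
  exact (hμ.trans_le hμt).not_ge (hg.2 ht)

end Duality

section Tensor

variable {A1 B1 A2 B2 : Type*}

theorem choiTensor_eq_submatrix (M : Matrix (A1 × B1) (A1 × B1) ℂ)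
    (N : Matrix (A2 × B2) (A2 × B2) ℂ) :
    choiTensor M N = (M ⊗ₖ N).submatrix (Equiv.prodProdProdComm A1 A2 B1 B2)
      (Equiv.prodProdProdComm A1 A2 B1 B2) := rfl

theorem choiTensor_PTb (M : Matrix (A1 × B1) (A1 × B1) ℂ) (N : Matrix (A2 × B2) (A2 × B2) ℂ) :
    PTb (choiTensor M N) = choiTensor (PTb M) (PTb N) := rfl

theorem choiTensor_kronecker_one [DecidableEq B1] [DecidableEq B2] (ρ : Matrix A1 A1 ℂ)
    (σ : Matrix A2 A2 ℂ) :
    choiTensor (ρ ⊗ₖ (1 : Matrix B1 B1 ℂ)) (σ ⊗ₖ (1 : Matrix B2 B2 ℂ)) =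
      (ρ ⊗ₖ σ) ⊗ₖ (1 : Matrix (B1 × B2) (B1 × B2) ℂ) := by
  ext p q
  rw [← Matrix.one_kronecker_one]
  simp only [choiTensor, Matrix.kroneckerMap_apply]
  ring

theorem trB_choiTensor [Fintype B1] [Fintype B2] (M : Matrix (A1 × B1) (A1 × B1) ℂ)
    (N : Matrix (A2 × B2) (A2 × B2) ℂ) : trB (choiTensor M N) = trB M ⊗ₖ trB N := by
  ext i j
  simp [trB, choiTensor, Matrix.kroneckerMap_apply, Finset.sum_mul_sum, Fintype.sum_prod_type]

theorem Matrix.IsHermitian.choiTensor {M : Matrix (A1 × B1) (A1 × B1) ℂ}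
    {N : Matrix (A2 × B2) (A2 × B2) ℂ} (hM : M.IsHermitian) (hN : N.IsHermitian) :
    (choiTensor M N).IsHermitian := by
  ext p q
  simp only [Matrix.conjTranspose_apply, _root_.choiTensor, star_mul', hM.apply, hN.apply]

variable [Fintype A1] [Fintype B1] [Fintype A2] [Fintype B2]

theorem Matrix.PosSemidef.choiTensor {M : Matrix (A1 × B1) (A1 × B1) ℂ}
    {N : Matrix (A2 × B2) (A2 × B2) ℂ} (hM : M.PosSemidef) (hN : N.PosSemidef) :
    (choiTensor M N).PosSemidef := by
  rw [choiTensor_eq_submatrix]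
  exact (hM.kronecker hN).submatrix _

theorem trace_choiTensor_mul (M M' : Matrix (A1 × B1) (A1 × B1) ℂ)
    (N N' : Matrix (A2 × B2) (A2 × B2) ℂ) :
    (choiTensor M N * choiTensor M' N').trace = (M * M').trace * (N * N').trace := by
  rw [choiTensor_eq_submatrix, choiTensor_eq_submatrix, Matrix.submatrix_mul_equiv,
    ← Matrix.mul_kronecker_mul, ← Matrix.trace_kronecker]
  exact Equiv.sum_comp (Equiv.prodProdProdComm A1 A2 B1 B2)
    fun x => ((M * M') ⊗ₖ (N * N')) x x

theorem mul_mem_GammaSet_choiTensor [DecidableEq B1] [DecidableEq B2]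
    {J1 : Matrix (A1 × B1) (A1 × B1) ℂ} {J2 : Matrix (A2 × B2) (A2 × B2) ℂ} {s t : ℝ}
    (hs : s ∈ GammaSet J1) (ht : t ∈ GammaSet J2) : s * t ∈ GammaSet (choiTensor J1 J2) := by
  classical
  obtain ⟨R, ρ, hR, hρ, hρ1, hlo, hhi, htr⟩ := hs
  obtain ⟨R', ρ', hR', hρ', hρ1', hlo', hhi', htr'⟩ := ht
  rw [Loe, sub_neg_eq_add] at hlo hlo'
  rw [Loe] at hhi hhi'
  refine ⟨choiTensor R R', ρ ⊗ₖ ρ', hR.choiTensor hR', hρ.kronecker hρ', ?_, ?_, ?_, ?_⟩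
  · rw [Matrix.trace_kronecker, hρ1, hρ1', one_mul]
  · rw [Loe, ← choiTensor_kronecker_one, choiTensor_PTb]
    convert ((hlo.choiTensor hlo').add (hhi.choiTensor hhi')).real_smul
      (c := 1 / 2) (by norm_num) using 1
    ext p q
    simp only [choiTensor, Matrix.sub_apply, Matrix.neg_apply, Matrix.add_apply,
      Matrix.smul_apply, Complex.real_smul]
    push_cast
    ring
  · rw [Loe, ← choiTensor_kronecker_one, choiTensor_PTb]
    convert ((hlo.choiTensor hhi').add (hhi.choiTensor hlo')).real_smul
      (c := 1 / 2) (by norm_num) using 1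
    ext p q
    simp only [choiTensor, Matrix.sub_apply, Matrix.add_apply,
      Matrix.smul_apply, Complex.real_smul]
    push_cast
    ring
  · rw [trace_choiTensor_mul, htr, htr', Complex.ofReal_mul]

theorem DualFeasible.choiTensor [DecidableEq A1] [DecidableEq A2]
    {K1 : Matrix (A1 × B1) (A1 × B1) ℂ} {K2 : Matrix (A2 × B2) (A2 × B2) ℂ} {μ ν : ℝ}
    (h1 : DualFeasible K1 μ) (h2 : DualFeasible K2 ν) (hν : 0 ≤ ν) :
    DualFeasible (choiTensor K1 K2) (μ * ν) := by
  obtain ⟨V, Y, hV, hY, rfl, hT⟩ := h1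
  obtain ⟨V', Y', hV', hY', rfl, hT'⟩ := h2
  refine ⟨_, _, (hV.choiTensor hV').add (hY.choiTensor hY'),
    (hV.choiTensor hY').add (hY.choiTensor hV'), ?_, ?_⟩
  · ext p q
    simp only [_root_.choiTensor, Matrix.sub_apply, Matrix.add_apply]
    ring
  · have hsum : _root_.choiTensor V V' + _root_.choiTensor Y Y' +
        (_root_.choiTensor V Y' + _root_.choiTensor Y V') =
        _root_.choiTensor (V + Y) (V' + Y') := by
      ext p q
      simp only [_root_.choiTensor, Matrix.add_apply]
      ring
    rw [hsum, trB_choiTensor]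
    have hsplit : (μ * ν) • (1 : Matrix (A1 × A2) (A1 × A2) ℂ) - trB (V + Y) ⊗ₖ trB (V' + Y') =
        (μ • (1 : Matrix A1 A1 ℂ) - trB (V + Y)) ⊗ₖ (ν • (1 : Matrix A2 A2 ℂ)) +
          trB (V + Y) ⊗ₖ (ν • (1 : Matrix A2 A2 ℂ) - trB (V' + Y')) := by
      rw [← Matrix.one_kronecker_one]
      ext p q
      simp only [Matrix.sub_apply, Matrix.add_apply, Matrix.smul_apply,
        Matrix.kroneckerMap_apply, Complex.real_smul]
      push_cast
      ring
    rw [hsplit]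
    exact (hT.kronecker (Matrix.PosSemidef.one.real_smul hν)).add
      ((hV.add hY).trB.kronecker hT')

end Tensor

/-- `Γ` is multiplicative under tensor products of channels:
`Γ(N ⊗ M) = Γ(N)·Γ(M)`, hence `Q_Γ(N ⊗ M) = Q_Γ(N) + Q_Γ(M)`. -/
theorem gamma_multiplicative
    {A1 B1 A2 B2 : Type*} [Fintype A1] [Fintype B1] [Fintype A2] [Fintype B2]
    [DecidableEq A1] [DecidableEq B1] [DecidableEq A2] [DecidableEq B2]
    (J1 : Matrix (A1 × B1) (A1 × B1) ℂ) (J2 : Matrix (A2 × B2) (A2 × B2) ℂ)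
    (hJ1 : J1.PosSemidef) (hJ1TP : trB J1 = 1)
    (hJ2 : J2.PosSemidef) (hJ2TP : trB J2 = 1)
    (g1 g2 : ℝ)
    (hg1 : IsGreatest (GammaSet J1) g1) (hg2 : IsGreatest (GammaSet J2) g2) :
    IsGreatest (GammaSet (choiTensor J1 J2)) (g1 * g2) ∧
    Real.log (g1 * g2) = Real.log g1 + Real.log g2 := by
  have h1 := one_le_of_isGreatest_GammaSet hJ1TP hg1
  have h2 := one_le_of_isGreatest_GammaSet hJ2TP hg2
  refine ⟨⟨mul_mem_GammaSet_choiTensor hg1.1 hg2.1, fun t ht => ?_⟩,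
    Real.log_mul (by positivity) (by positivity)⟩
  have hbound : ∀ ε : ℝ, 0 < ε → t ≤ (g1 + ε) * (g2 + ε) := fun ε hε =>
    le_of_mem_GammaSet_of_dualFeasible ht
      ((dualFeasible_of_isGreatest_lt hJ1.1 hg1 (lt_add_of_pos_right g1 hε)).choiTensor
        (dualFeasible_of_isGreatest_lt hJ2.1 hg2 (lt_add_of_pos_right g2 hε)) (by positivity))
  have hcont : Filter.Tendsto (fun ε : ℝ => (g1 + ε) * (g2 + ε)) (nhdsWithin 0 (Set.Ioi 0))
      (nhds (g1 * g2)) := by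
    have h : Continuous fun ε : ℝ => (g1 + ε) * (g2 + ε) := by fun_prop
    simpa using (h.tendsto 0).mono_left nhdsWithin_le_nhds
  exact ge_of_tendsto hcont (Filter.eventually_of_mem self_mem_nhdsWithin hbound)
end

section
/- For any quantum channel N, a noiseless qudit channel I_d, and k > 0: F^{PPTp}(N ⊗ I_d, k d) = F^{PPTp}(N, k). In particular κ^{PPTp}(N ⊗ I_d) = d · κ^{PPTp}(N), where κ^{PPTp}(N) = max{k ≥ 0 : F^{PPTp}(N, k) = 1}. -/
open Matrix
open scoped Kronecker ComplexOrder

/-- Values of the PPT-preserving fidelity SDP `F^{PPTp}(N, k)`. -/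
def FSet {A B : Type*} [Fintype A] [Fintype B] [DecidableEq B]
    (J : Matrix (A × B) (A × B) ℂ) (k : ℝ) : Set ℝ :=
  {t : ℝ | ∃ (W : Matrix (A × B) (A × B) ℂ) (ρ : Matrix A A ℂ),
    ρ.PosSemidef ∧ ρ.trace = 1 ∧ W.PosSemidef ∧
    Loe W (ρ ⊗ₖ (1 : Matrix B B ℂ)) ∧
    Loe (-(((k : ℂ))⁻¹ • (ρ ⊗ₖ (1 : Matrix B B ℂ)))) (PTb W) ∧
    Loe (PTb W) (((k : ℂ))⁻¹ • (ρ ⊗ₖ (1 : Matrix B B ℂ))) ∧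
    (J * W).trace = (t : ℂ)}

/-- `κ^{PPTp}(N)` is the greatest element of this set:
`{k ≥ 0 : F^{PPTp}(N, k) = 1}`. -/
def KSet {A B : Type*} [Fintype A] [Fintype B] [DecidableEq B]
    (J : Matrix (A × B) (A × B) ℂ) : Set ℝ :=
  {k : ℝ | 0 ≤ k ∧ IsGreatest (FSet J k) 1}

/-- The unnormalized maximally entangled projector `Φ_d`, the Choi matrix of
the noiseless qudit channel `I_d`. -/
def Phi (d : ℕ) : Matrix (Fin d × Fin d) (Fin d × Fin d) ℂ :=
  fun p q => if p.1 = p.2 ∧ q.1 = q.2 then 1 else 0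

/-- Choi matrix of `N ⊗ I_d`, i.e. `J_N ⊗ Φ_d` with factors reordered. -/
def choiWithId {A B : Type*} (J : Matrix (A × B) (A × B) ℂ) (d : ℕ) :
    Matrix ((A × Fin d) × (B × Fin d)) ((A × Fin d) × (B × Fin d)) ℂ :=
  fun p q => J (p.1.1, p.2.1) (q.1.1, q.2.1) * Phi d (p.1.2, p.2.2) (q.1.2, q.2.2)

/-- Tensor product of bipartite matrices, with the factors regrouped as `(A C) × (B D)`. -/
def regroupKronecker {A B C D : Type*} (X : Matrix (A × B) (A × B) ℂ)
    (Y : Matrix (C × D) (C × D) ℂ) : Matrix ((A × C) × (B × D)) ((A × C) × (B × D)) ℂ :=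
  (X ⊗ₖ Y).submatrix (Equiv.prodProdProdComm A C B D) (Equiv.prodProdProdComm A C B D)

lemma regroupKronecker_apply {A B C D : Type*} (X : Matrix (A × B) (A × B) ℂ)
    (Y : Matrix (C × D) (C × D) ℂ) (p q : (A × C) × (B × D)) :
    regroupKronecker X Y p q =
      X (p.1.1, p.2.1) (q.1.1, q.2.1) * Y (p.1.2, p.2.2) (q.1.2, q.2.2) := rfl

lemma regroupKronecker_posSemidef {A B C D : Type*} [Fintype A] [Fintype B] [Fintype C] [Fintype D]
    {X : Matrix (A × B) (A × B) ℂ} {Y : Matrix (C × D) (C × D) ℂ}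
    (hX : X.PosSemidef) (hY : Y.PosSemidef) : (regroupKronecker X Y).PosSemidef := by
  classical exact (hX.kronecker hY).submatrix _

lemma PTb_regroupKronecker {A B C D : Type*} (X : Matrix (A × B) (A × B) ℂ)
    (Y : Matrix (C × D) (C × D) ℂ) :
    PTb (regroupKronecker X Y) = regroupKronecker (PTb X) (PTb Y) := rfl

lemma trace_regroupKronecker_mul {A B C D : Type*} [Fintype A] [Fintype B] [Fintype C] [Fintype D]
    (X X' : Matrix (A × B) (A × B) ℂ) (Y Y' : Matrix (C × D) (C × D) ℂ) :
    (regroupKronecker X Y * regroupKronecker X' Y').trace = (X * X').trace * (Y * Y').trace := by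
  unfold regroupKronecker
  rw [submatrix_mul_equiv, ← mul_kronecker_mul, ← trace_kronecker]
  exact (Equiv.prodProdProdComm A C B D).sum_comp fun i => ((X * X') ⊗ₖ (Y * Y')) i i

lemma choiWithId_eq {A B : Type*} (J : Matrix (A × B) (A × B) ℂ) (d : ℕ) :
    choiWithId J d = regroupKronecker J (Phi d) := rfl

/-- A Hermitian matrix with `Q * Q = c • Q` and `c > 0` is positive semidefinite. -/
lemma posSemidef_of_mul_self_eq_smul {n : Type*} [Fintype n] {Q : Matrix n n ℂ} {c : ℝ}
    (hc : 0 < c) (hQ : Q.IsHermitian) (h : Q * Q = (c : ℂ) • Q) : Q.PosSemidef := by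
  have hc' : (c : ℂ) ≠ 0 := by exact_mod_cast hc.ne'
  have : Q = ((c : ℂ)⁻¹) • (Qᴴ * Q) := by
    rw [hQ.eq, h, smul_smul, inv_mul_cancel₀ hc', one_smul]
  rw [this]
  refine (posSemidef_conjTranspose_mul_self Q).smul ?_
  rw [← Complex.ofReal_inv]
  exact_mod_cast inv_nonneg.2 hc.le

lemma Phi_isHermitian (d : ℕ) : (Phi d).IsHermitian := by
  ext p q
  simp [Phi, conjTranspose_apply, and_comm, apply_ite]

lemma Phi_mul_Phi (d : ℕ) : Phi d * Phi d = (d : ℂ) • Phi d := by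
  ext ⟨a, b⟩ ⟨a', b'⟩
  simp only [Phi, mul_apply, Matrix.smul_apply, Fintype.sum_prod_type]
  by_cases h : a = b <;> by_cases h' : a' = b' <;> simp [h, h']

lemma trace_Phi (d : ℕ) : (Phi d).trace = d := by
  simp only [Phi, trace, diag_apply, Fintype.sum_prod_type]
  simp

lemma Phi_posSemidef {d : ℕ} (hd : 0 < d) : (Phi d).PosSemidef :=
  posSemidef_of_mul_self_eq_smul (c := d) (by exact_mod_cast hd) (Phi_isHermitian d)
    (by simpa using Phi_mul_Phi d)

lemma smul_one_sub_Phi_posSemidef {d : ℕ} (hd : 0 < d) :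
    ((d : ℂ) • (1 : Matrix (Fin d × Fin d) (Fin d × Fin d) ℂ) - Phi d).PosSemidef := by
  refine posSemidef_of_mul_self_eq_smul (c := d) (by exact_mod_cast hd) ?_ ?_
  · simp [IsHermitian, (Phi_isHermitian d).eq]
  · simp [sub_mul, mul_sub, Phi_mul_Phi, smul_sub]

lemma PTb_Phi_mul_self (d : ℕ) : PTb (Phi d) * PTb (Phi d) = 1 := by
  ext ⟨a, b⟩ ⟨a', b'⟩
  simp only [Phi, PTb, mul_apply, Fintype.sum_prod_type, one_apply, Prod.mk.injEq]
  by_cases h : a = a' <;> by_cases h' : b = b' <;> simp [h, h', ite_and, eq_comm]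

lemma PTb_Phi_isHermitian (d : ℕ) : (PTb (Phi d)).IsHermitian := by
  ext p q
  simp [Phi, PTb, conjTranspose_apply, apply_ite, eq_comm, and_comm]

lemma one_add_PTb_Phi_posSemidef (d : ℕ) : (1 + PTb (Phi d)).PosSemidef := by
  refine posSemidef_of_mul_self_eq_smul (c := 2) two_pos ?_ ?_
  · simp [IsHermitian, (PTb_Phi_isHermitian d).eq]
  · simp only [add_mul, mul_add, PTb_Phi_mul_self, one_mul, mul_one]
    push_cast
    module

lemma one_sub_PTb_Phi_posSemidef (d : ℕ) : (1 - PTb (Phi d)).PosSemidef := by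
  refine posSemidef_of_mul_self_eq_smul (c := 2) two_pos ?_ ?_
  · simp [IsHermitian, (PTb_Phi_isHermitian d).eq]
  · simp only [sub_mul, mul_sub, PTb_Phi_mul_self, one_mul, mul_one]
    push_cast
    module

lemma regroupKronecker_kronecker_one {A B C D : Type*} [DecidableEq B] [DecidableEq D]
    (ρ : Matrix A A ℂ) (σ : Matrix C C ℂ) :
    (ρ ⊗ₖ σ) ⊗ₖ (1 : Matrix (B × D) (B × D) ℂ) =
      regroupKronecker (ρ ⊗ₖ (1 : Matrix B B ℂ)) (σ ⊗ₖ (1 : Matrix D D ℂ)) := by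
  ext p q
  simp only [regroupKronecker_apply, kroneckerMap_apply, one_apply, Prod.ext_iff]
  by_cases h : p.2.1 = q.2.1 <;> by_cases h' : p.2.2 = q.2.2 <;> simp [h, h']

lemma FSet_subset_FSet_choiWithId {A B : Type*} [Fintype A] [Fintype B]
    [DecidableEq B] (J : Matrix (A × B) (A × B) ℂ) {d : ℕ} (hd : 0 < d) (k : ℝ) :
    FSet J k ⊆ FSet (choiWithId J d) (k * d) := by
  classical
  rintro t ⟨W, ρ, hρ, hρ1, hW, hWle, hlo, hhi, ht⟩
  have hd' : (d : ℂ) ≠ 0 := by exact_mod_cast hd.ne'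
  have hdi : (0 : ℂ) ≤ (d : ℂ)⁻¹ := by positivity
  have hdi2 : (0 : ℂ) ≤ (d : ℂ)⁻¹ * (d : ℂ)⁻¹ := mul_nonneg hdi hdi
  have h2 : (0 : ℂ) ≤ (2 : ℂ)⁻¹ := by positivity
  unfold Loe at hWle hlo hhi
  have hid : (ρ ⊗ₖ ((d : ℂ)⁻¹ • (1 : Matrix (Fin d) (Fin d) ℂ))) ⊗ₖ
      (1 : Matrix (B × Fin d) (B × Fin d) ℂ) =
      (d : ℂ)⁻¹ • regroupKronecker (ρ ⊗ₖ (1 : Matrix B B ℂ)) 1 := by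
    rw [regroupKronecker_kronecker_one, smul_kronecker, one_kronecker_one]
    ext p q
    simp only [regroupKronecker_apply, Matrix.smul_apply, smul_eq_mul]
    ring
  refine ⟨((d : ℂ)⁻¹ * (d : ℂ)⁻¹) • regroupKronecker W (Phi d),
    ρ ⊗ₖ ((d : ℂ)⁻¹ • (1 : Matrix (Fin d) (Fin d) ℂ)),
    hρ.kronecker (PosSemidef.one.smul hdi), ?_, (regroupKronecker_posSemidef hW
      (Phi_posSemidef hd)).smul hdi2, ?_, ?_, ?_, ?_⟩
  · simp [trace_kronecker, hρ1, trace_smul, hd']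
  · rw [hid, Loe]
    convert ((regroupKronecker_posSemidef hWle (Phi_posSemidef hd)).add
      (regroupKronecker_posSemidef (hρ.kronecker (PosSemidef.one (n := B) (R := ℂ)))
        (smul_one_sub_Phi_posSemidef hd))).smul hdi2 using 1
    ext p q
    simp only [regroupKronecker_apply, Matrix.smul_apply, smul_eq_mul, Matrix.add_apply,
      Matrix.sub_apply]
    field_simp
    ring
  · rw [hid, Loe]
    convert ((regroupKronecker_posSemidef hlo (one_add_PTb_Phi_posSemidef d)).add
      (regroupKronecker_posSemidef hhi (one_sub_PTb_Phi_posSemidef d))).smul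
        (mul_nonneg h2 hdi2) using 1
    ext p q
    rw [show PTb (((d : ℂ)⁻¹ * (d : ℂ)⁻¹) • regroupKronecker W (Phi d)) =
      ((d : ℂ)⁻¹ * (d : ℂ)⁻¹) • regroupKronecker (PTb W) (PTb (Phi d)) from rfl]
    simp only [regroupKronecker_apply, Matrix.smul_apply, smul_eq_mul, Matrix.add_apply,
      Matrix.sub_apply, Matrix.neg_apply,
      Complex.ofReal_mul, Complex.ofReal_natCast, mul_inv]
    ring
  · rw [hid, Loe]
    convert ((regroupKronecker_posSemidef hlo (one_sub_PTb_Phi_posSemidef d)).add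
      (regroupKronecker_posSemidef hhi (one_add_PTb_Phi_posSemidef d))).smul
        (mul_nonneg h2 hdi2) using 1
    ext p q
    rw [show PTb (((d : ℂ)⁻¹ * (d : ℂ)⁻¹) • regroupKronecker W (Phi d)) =
      ((d : ℂ)⁻¹ * (d : ℂ)⁻¹) • regroupKronecker (PTb W) (PTb (Phi d)) from rfl]
    simp only [regroupKronecker_apply, Matrix.smul_apply, smul_eq_mul, Matrix.add_apply,
      Matrix.sub_apply, Matrix.neg_apply,
      Complex.ofReal_mul, Complex.ofReal_natCast, mul_inv]
    ring
  · rw [choiWithId_eq, mul_smul_comm, trace_smul, trace_regroupKronecker_mul, ht, Phi_mul_Phi,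
      trace_smul, trace_Phi]
    simp only [smul_eq_mul]
    field_simp

/-- The inclusion of `A × B` into `(A × C) × (B × D)` at fixed second coordinates. -/
def slot {A B C D : Type*} (i : C) (j : D) (x : A × B) : (A × C) × (B × D) :=
  ((x.1, i), (x.2, j))

/-- The compression `(1 ⊗ w)ᴴ M (1 ⊗ w)` by a vector `w = ∑ i ∈ s, v i • e_(p i)` of `ℂ^(C × D)`
preserves positive semidefiniteness. -/
lemma compress_posSemidef {A B C D : Type*} [Fintype A] [Fintype B] [Fintype C] [Fintype D]
    {M : Matrix ((A × C) × (B × D)) ((A × C) × (B × D)) ℂ} (hM : M.PosSemidef)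
    {ι : Type*} (s : Finset ι) (p : ι → C × D) (v : ι → ℂ) :
    (∑ i ∈ s, ∑ j ∈ s, (star (v i) * v j) •
      M.submatrix (slot (A := A) (B := B) (p i).1 (p i).2) (slot (p j).1 (p j).2)).PosSemidef := by
  classical
  convert hM.conjTranspose_mul_mul_same (∑ i ∈ s, v i •
    (1 : Matrix ((A × C) × (B × D)) ((A × C) × (B × D)) ℂ).submatrix id
      (slot (A := A) (B := B) (p i).1 (p i).2)) using 1
  simp only [conjTranspose_sum, conjTranspose_smul, Matrix.sum_mul, Matrix.mul_sum, Matrix.smul_mul,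
    Matrix.mul_smul, Finset.smul_sum, smul_smul, conjTranspose_submatrix, conjTranspose_one]
  rw [Finset.sum_comm]
  refine Finset.sum_congr rfl fun i _ => Finset.sum_congr rfl fun j _ => ?_
  congr 1
  · ring
  · ext x y
    simp [mul_apply, one_apply]

/-- Compression onto the maximally entangled vector: `⟨Φ_d| M |Φ_d⟩`. -/
noncomputable def phiCompress {A B C : Type*} [Fintype C]
    (M : Matrix ((A × C) × (B × C)) ((A × C) × (B × C)) ℂ) : Matrix (A × B) (A × B) ℂ :=
  ∑ i, ∑ j, M.submatrix (slot i i) (slot j j)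

/-- Partial trace over the second coordinates. -/
noncomputable def auxTrace {A B C : Type*} [Fintype C]
    (M : Matrix ((A × C) × (B × C)) ((A × C) × (B × C)) ℂ) : Matrix (A × B) (A × B) ℂ :=
  ∑ i, ∑ j, M.submatrix (slot i j) (slot i j)

/-- Partial trace over the second coordinates after multiplication by their swap. -/
noncomputable def swapTrace {A B C : Type*} [Fintype C]
    (M : Matrix ((A × C) × (B × C)) ((A × C) × (B × C)) ℂ) : Matrix (A × B) (A × B) ℂ :=
  ∑ i, ∑ j, M.submatrix (slot i j) (slot j i)

section
variable {A B C : Type*} [Fintype C]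

lemma phiCompress_posSemidef [Fintype A] [Fintype B]
    {M : Matrix ((A × C) × (B × C)) ((A × C) × (B × C)) ℂ}
    (hM : M.PosSemidef) : (phiCompress M).PosSemidef := by
  simpa [phiCompress] using compress_posSemidef hM Finset.univ (fun i => (i, i)) fun _ => 1

lemma auxTrace_add_smul_swapTrace_posSemidef [Fintype A] [Fintype B]
    {M : Matrix ((A × C) × (B × C)) ((A × C) × (B × C)) ℂ}
    (hM : M.PosSemidef) {ε : ℂ} (hε : star ε = ε) (hε' : ε * ε = 1) :
    (auxTrace M + ε • swapTrace M).PosSemidef := by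
  have h2 : (0 : ℂ) ≤ (2 : ℂ)⁻¹ := by positivity
  convert (posSemidef_sum Finset.univ fun i _ => posSemidef_sum Finset.univ fun j _ =>
    compress_posSemidef hM Finset.univ (fun b : Bool => if b then (i, j) else (j, i))
      fun b : Bool => if b then 1 else ε).smul h2 using 1
  have ha : auxTrace M = ∑ i, ∑ j, M.submatrix (slot j i) (slot j i) := Finset.sum_comm
  have hs : swapTrace M = ∑ i, ∑ j, M.submatrix (slot j i) (slot i j) := Finset.sum_comm
  simp only [Fintype.sum_bool, Finset.sum_add_distrib, if_true, star_one, one_mul, one_smul, hε,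
    hε', mul_one, Bool.false_eq_true, if_false, ← Finset.smul_sum, ← ha, ← hs]
  change _ = (2 : ℂ)⁻¹ • (auxTrace M + ε • swapTrace M + (ε • swapTrace M + auxTrace M))
  module

lemma PTb_phiCompress (M : Matrix ((A × C) × (B × C)) ((A × C) × (B × C)) ℂ) :
    PTb (phiCompress M) = swapTrace (PTb M) := by
  ext x y
  simp [PTb, phiCompress, swapTrace, Matrix.sum_apply, slot]

lemma auxTrace_add_swapTrace_posSemidef [Fintype A] [Fintype B]
    {X Y : Matrix ((A × C) × (B × C)) ((A × C) × (B × C)) ℂ}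
    (hadd : (X + Y).PosSemidef) (hsub : (X - Y).PosSemidef) :
    (auxTrace X + swapTrace Y).PosSemidef := by
  have h2 : (0 : ℂ) ≤ (2 : ℂ)⁻¹ := by positivity
  convert ((auxTrace_add_smul_swapTrace_posSemidef hadd (ε := 1) (by simp) (by simp)).add
    (auxTrace_add_smul_swapTrace_posSemidef hsub (ε := -1) (by simp) (by simp))).smul h2 using 1
  simp only [auxTrace, swapTrace, submatrix_add, submatrix_sub, Pi.add_apply, Pi.sub_apply,
    Finset.sum_add_distrib, Finset.sum_sub_distrib]
  module

variable [DecidableEq B] [DecidableEq C]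

lemma phiCompress_kronecker_one (ρ : Matrix (A × C) (A × C) ℂ) :
    phiCompress (ρ ⊗ₖ (1 : Matrix (B × C) (B × C) ℂ)) = trB ρ ⊗ₖ (1 : Matrix B B ℂ) := by
  ext x y
  by_cases h : x.2 = y.2 <;>
    simp [phiCompress, trB, Matrix.sum_apply, slot, one_apply, h]

lemma auxTrace_kronecker_one (ρ : Matrix (A × C) (A × C) ℂ) :
    auxTrace (ρ ⊗ₖ (1 : Matrix (B × C) (B × C) ℂ)) =
      (Fintype.card C : ℂ) • (trB ρ ⊗ₖ (1 : Matrix B B ℂ)) := by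
  ext x y
  by_cases h : x.2 = y.2 <;>
    simp [auxTrace, trB, Matrix.sum_apply, slot, one_apply, h, Finset.mul_sum]

end

lemma trB_posSemidef {A B : Type*} [Fintype A] [Fintype B] {M : Matrix (A × B) (A × B) ℂ}
    (hM : M.PosSemidef) : (trB M).PosSemidef := by
  convert posSemidef_sum Finset.univ fun b _ => hM.submatrix fun a : A => (a, b)
  ext i j
  simp [trB, Matrix.sum_apply]

lemma trace_trB {A B : Type*} [Fintype A] [Fintype B] (M : Matrix (A × B) (A × B) ℂ) :
    (trB M).trace = M.trace := by
  simp [trB, trace, Fintype.sum_prod_type]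

lemma trace_choiWithId_mul {A B : Type*} [Fintype A] [Fintype B] (J : Matrix (A × B) (A × B) ℂ)
    {d : ℕ} (W : Matrix ((A × Fin d) × (B × Fin d)) ((A × Fin d) × (B × Fin d)) ℂ) :
    (choiWithId J d * W).trace = (J * phiCompress W).trace := by
  simp only [trace, diag_apply, mul_apply, ← Fintype.sum_prod_type']
  simp only [phiCompress, Matrix.sum_apply, Finset.mul_sum]
  rw [← (Equiv.prodCongr (Equiv.prodProdProdComm A B (Fin d) (Fin d))
    (Equiv.prodProdProdComm A B (Fin d) (Fin d))).sum_comp]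
  simp only [choiWithId, Phi, Fintype.sum_prod_type, submatrix_apply, slot, Equiv.prodCongr_apply,
    Equiv.prodProdProdComm_apply, Prod.map, ite_and, mul_ite, ite_mul, mul_one, mul_zero, zero_mul,
    Finset.sum_ite_eq, Finset.sum_ite_irrel, Finset.sum_const_zero, Finset.mem_univ, if_true]
  refine Finset.sum_congr rfl fun a _ => Finset.sum_congr rfl fun b _ => ?_
  rw [Finset.sum_comm]
  refine Finset.sum_congr rfl fun a' _ => ?_
  rw [Finset.sum_comm]
  exact Finset.sum_congr rfl fun b' _ => Finset.sum_comm

lemma FSet_choiWithId_subset_FSet {A B : Type*} [Fintype A] [Fintype B]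
    [DecidableEq B] (J : Matrix (A × B) (A × B) ℂ) {d : ℕ} (hd : 0 < d) (k : ℝ) :
    FSet (choiWithId J d) (k * d) ⊆ FSet J k := by
  rintro t ⟨W, ρ, hρ, hρ1, hW, hWle, hlo, hhi, ht⟩
  have hd' : (d : ℂ) ≠ 0 := by exact_mod_cast hd.ne'
  unfold Loe at hWle hlo hhi
  set X := (((k * d : ℝ) : ℂ))⁻¹ • (ρ ⊗ₖ (1 : Matrix (B × Fin d) (B × Fin d) ℂ))
  have haux : auxTrace X = ((k : ℂ))⁻¹ • (trB ρ ⊗ₖ (1 : Matrix B B ℂ)) := by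
    have : auxTrace X = (((k * d : ℝ) : ℂ))⁻¹ •
        auxTrace (ρ ⊗ₖ (1 : Matrix (B × Fin d) (B × Fin d) ℂ)) := by
      simp only [auxTrace, Finset.smul_sum]
      rfl
    rw [this, auxTrace_kronecker_one, smul_smul, Fintype.card_fin]
    congr 1
    push_cast
    field_simp
  refine ⟨phiCompress W, trB ρ, trB_posSemidef hρ, by rw [trace_trB, hρ1],
    phiCompress_posSemidef hW, ?_, ?_, ?_, by rw [← trace_choiWithId_mul, ht]⟩
  · rw [← phiCompress_kronecker_one, Loe]
    convert phiCompress_posSemidef hWle using 1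
    simp [phiCompress, submatrix_sub, Finset.sum_sub_distrib]
  · rw [← haux, Loe, PTb_phiCompress]
    convert auxTrace_add_swapTrace_posSemidef (X := X) (Y := PTb W) (by simpa [add_comm] using hlo)
      hhi using 1
    abel
  · rw [← haux, Loe, PTb_phiCompress]
    convert auxTrace_add_swapTrace_posSemidef (X := X) (Y := -PTb W)
      (by simpa [sub_eq_add_neg] using hhi) (by simpa [add_comm] using hlo) using 1
    simp only [swapTrace, submatrix_neg, Pi.neg_apply, Finset.sum_neg_distrib, sub_eq_add_neg]

lemma FSet_choiWithId {A B : Type*} [Fintype A] [Fintype B]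
    [DecidableEq B] (J : Matrix (A × B) (A × B) ℂ) {d : ℕ} (hd : 0 < d) (k : ℝ) :
    FSet (choiWithId J d) (k * d) = FSet J k :=
  (FSet_choiWithId_subset_FSet J hd k).antisymm (FSet_subset_FSet_choiWithId J hd k)

/-- `F^{PPTp}(N ⊗ I_d, kd) = F^{PPTp}(N, k)`, and consequently
`κ^{PPTp}(N ⊗ I_d) = d · κ^{PPTp}(N)`. -/
theorem ppt_fidelity_tensor_qudit
    {A B : Type*} [Fintype A] [Fintype B] [DecidableEq A] [DecidableEq B]
    (J : Matrix (A × B) (A × B) ℂ) (hJ : J.PosSemidef) (hTP : trB J = 1)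
    (d : ℕ) (hd : 0 < d) :
    (∀ (k : ℝ), 0 < k → ∀ f : ℝ,
      (IsGreatest (FSet J k) f ↔ IsGreatest (FSet (choiWithId J d) (k * d)) f)) ∧
    (∀ c : ℝ, IsGreatest (KSet J) c →
      IsGreatest (KSet (choiWithId J d)) ((d : ℝ) * c)) := by
  refine ⟨fun k _ f => by rw [FSet_choiWithId J hd], fun c hc => ⟨⟨?_, ?_⟩, ?_⟩⟩
  · exact mul_nonneg (Nat.cast_nonneg d) hc.1.1
  · rw [mul_comm, FSet_choiWithId J hd]
    exact hc.1.2
  · rintro k ⟨hk0, hk⟩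
    have hd' : (0 : ℝ) < d := by exact_mod_cast hd
    rw [← div_mul_cancel₀ k hd'.ne', FSet_choiWithId J hd] at hk
    have := hc.2 ⟨div_nonneg hk0 hd'.le, hk⟩
    rwa [div_le_iff₀' hd'] at this
end
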